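/- Testable implication of syntactic rule (1) of Theorem 5: let X, Y, Z be partially observed random variables with missingness indicators R_X, R_Y, R_Z and proxies X*, Y*, Z*. If X is conditionally independent of Y given (Z, R_X, R_Y, R_Z), then for all values x, y, z with P(Y* = some y, Z* = some z, R_X = 0, R_Y = 0, R_Z = 0) > 0 one has P(X* = some x | Z* = some z, R_X = 0, R_Y = 0, R_Z = 0) = P(X* = some x | Y* = some y, Z* = some z, R_X = 0, R_Y = 0, R_Z = 0); that is, the independence claim implies an identity expressed entirely in terms of the observed-data distribution. -/

import Mathlib

open MeasureTheory

/-- Elementary conditional probability `P(A | B)`. -/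
noncomputable def cpr {Ω : Type*} [MeasurableSpace Ω] (P : Measure Ω) (A B : Set Ω) : ENNReal :=
  P (A ∩ B) / P B

/-- Proxy variable: `X* = some X` when the indicator is `false` (observed, `R = 0`),
and `X* = none` when the indicator is `true` (missing, `R = 1`). -/
def proxy {Ω α : Type*} (X : Ω → α) (R : Ω → Bool) (ω : Ω) : Option α :=
  if R ω = false then some (X ω) else none

/-- If `A` and `B` are conditionally independent given `C`, then further conditioning on `B`
does not change the conditional probability of `A` given `C`. -/
theorem cpr_eq_cpr_inter_of_cpr_inter_eq_mul {Ω : Type*} [MeasurableSpace Ω] (P : Measure Ω)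
    [IsFiniteMeasure P] {A B C : Set Ω} (h : cpr P (A ∩ B) C = cpr P A C * cpr P B C)
    (hBC : P (B ∩ C) ≠ 0) : cpr P A C = cpr P A (B ∩ C) := by
  have hC : P C ≠ 0 := fun h0 => hBC (measure_mono_null Set.inter_subset_right h0)
  have hC' : P C ≠ ⊤ := measure_ne_top P C
  have hBC' : P (B ∩ C) ≠ ⊤ := measure_ne_top P _
  unfold cpr at h ⊢
  have key : P (A ∩ (B ∩ C)) = P (A ∩ C) / P C * P (B ∩ C) := by
    rw [← Set.inter_assoc, ← ENNReal.div_mul_cancel (a := P C) (b := P (A ∩ B ∩ C)) hC hC', h,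
      mul_assoc, ENNReal.div_mul_cancel hC hC']
  rw [key, ENNReal.mul_div_cancel_right hBC hBC']

theorem proxy_eq_some_iff {Ω α : Type*} {X : Ω → α} {R : Ω → Bool} {ω : Ω} {x : α}
    (h : R ω = false) : proxy X R ω = some x ↔ X ω = x := by
  simp [proxy, h]

/-- **Testable implication of syntactic rule (1) of Theorem 5.**
If `X ⟂ Y | (Z, R_X, R_Y, R_Z)`, then for all `x, y, z` with
`P(Y* = some y, Z* = some z, R_X = 0, R_Y = 0, R_Z = 0) > 0`,
`P(X* = some x | Z* = some z, R = 0) = P(X* = some x | Y* = some y, Z* = some z, R = 0)`,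
an identity expressed entirely in terms of the observed-data distribution. -/
theorem testable_rule_one
    {Ω α β γ : Type*} [MeasurableSpace Ω]
    [Fintype α] [Nonempty α] [Fintype β] [Nonempty β] [Fintype γ] [Nonempty γ]
    (P : Measure Ω) [IsProbabilityMeasure P]
    (X : Ω → α) (Y : Ω → β) (Z : Ω → γ) (RX RY RZ : Ω → Bool)
    -- X is conditionally independent of Y given (Z, RX, RY, RZ):
    (hCI : ∀ (x : α) (y : β) (z : γ) (rx ry rz : Bool),
      cpr P ({ω | X ω = x} ∩ {ω | Y ω = y})
          {ω | Z ω = z ∧ RX ω = rx ∧ RY ω = ry ∧ RZ ω = rz} =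
        cpr P {ω | X ω = x} {ω | Z ω = z ∧ RX ω = rx ∧ RY ω = ry ∧ RZ ω = rz} *
          cpr P {ω | Y ω = y} {ω | Z ω = z ∧ RX ω = rx ∧ RY ω = ry ∧ RZ ω = rz}) :
    ∀ (x : α) (y : β) (z : γ),
      0 < P {ω | proxy Y RY ω = some y ∧ proxy Z RZ ω = some z ∧
                 RX ω = false ∧ RY ω = false ∧ RZ ω = false} →
      cpr P {ω | proxy X RX ω = some x}
          {ω | proxy Z RZ ω = some z ∧ RX ω = false ∧ RY ω = false ∧ RZ ω = false} =
        cpr P {ω | proxy X RX ω = some x}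
          {ω | proxy Y RY ω = some y ∧ proxy Z RZ ω = some z ∧
               RX ω = false ∧ RY ω = false ∧ RZ ω = false} := by
  intro x y z hpos
  set C : Set Ω := {ω | Z ω = z ∧ RX ω = false ∧ RY ω = false ∧ RZ ω = false}
  have hZ : {ω | proxy Z RZ ω = some z ∧ RX ω = false ∧ RY ω = false ∧ RZ ω = false} = C := by
    ext ω
    exact and_congr_left fun h => proxy_eq_some_iff h.2.2
  have hYZ : {ω | proxy Y RY ω = some y ∧ proxy Z RZ ω = some z ∧
      RX ω = false ∧ RY ω = false ∧ RZ ω = false} = {ω | Y ω = y} ∩ C := by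
    rw [← hZ]
    ext ω
    exact and_congr_left fun h => proxy_eq_some_iff h.2.2.1
  have hX : ∀ D ⊆ C, cpr P {ω | proxy X RX ω = some x} D = cpr P {ω | X ω = x} D := by
    intro D hD
    have : {ω | proxy X RX ω = some x} ∩ D = {ω | X ω = x} ∩ D := by
      ext ω
      exact and_congr_left fun h => proxy_eq_some_iff (hD h).2.1
    rw [cpr, cpr, this]
  rw [hYZ] at hpos
  rw [hZ, hYZ, hX C subset_rfl, hX _ Set.inter_subset_right]
  exact cpr_eq_cpr_inter_of_cpr_inter_eq_mul P (hCI x y z false false false) hpos.ne'
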